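/- arXiv:2605.09301 — 3 statements merged into one kernel-verified Lean document; each statement's English description precedes it below -/
import Mathlib

section
/- Let a : Fin n → ℝ and b : Fin m → ℝ be nonnegative marginal vectors with Σ_i a i = Σ_j b j, and let U(a, b) = { Π : Matrix (Fin n) (Fin m) ℝ : (∀ i j, 0 ≤ Π i j) ∧ (∀ i, Σ_j Π i j = a i) ∧ (∀ j, Σ_i Π i j = b j) } be the transport polytope, assumed nonempty. Let C : Matrix (Fin n) (Fin m) ℝ be any cost matrix and ε > 0, and define the entropic optimal transport objective F(Π) = Σ_{i,j} C i j · Π i j + ε · Σ_{i,j} Π i j · log (Π i j), with the convention 0 · log 0 = 0. Then F attains its minimum on U(a, b) at exactly one point: there exists a unique Π* ∈ U(a, b) such that F(Π*) ≤ F(Π) for all Π ∈ U(a, b). -/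
/-- The transport polytope: entrywise-nonnegative matrices with row sums `a`
and column sums `b`. -/
def transportPolytope {n m : ℕ} (a : Fin n → ℝ) (b : Fin m → ℝ) :
    Set (Matrix (Fin n) (Fin m) ℝ) :=
  {P | (∀ i j, 0 ≤ P i j) ∧ (∀ i, ∑ j, P i j = a i) ∧ (∀ j, ∑ i, P i j = b j)}

/-- The entropic optimal transport objective
`F(Π) = ⟨C, Π⟩ + ε Σ Π i j log (Π i j)` (note `Real.log 0 = 0`, so the
convention `0 · log 0 = 0` holds automatically). -/
noncomputable def entropicOT {n m : ℕ} (C : Matrix (Fin n) (Fin m) ℝ) (ε : ℝ)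
    (P : Matrix (Fin n) (Fin m) ℝ) : ℝ :=
  (∑ i, ∑ j, C i j * P i j) + ε * ∑ i, ∑ j, P i j * Real.log (P i j)

theorem isCompact_transportPolytope {n m : ℕ} (a : Fin n → ℝ) (b : Fin m → ℝ) :
    IsCompact (transportPolytope a b) := by
  have hbox : IsCompact (Set.pi Set.univ fun i : Fin n =>
      Set.pi Set.univ fun _ : Fin m => Set.Icc (0 : ℝ) (a i)) :=
    isCompact_univ_pi fun _ => isCompact_univ_pi fun _ => isCompact_Icc
  refine hbox.of_isClosed_subset ?_ ?_
  · simp only [transportPolytope, Set.ofPred_and, Set.ofPred_forall]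
    refine .inter ?_ (.inter ?_ ?_)
    · exact isClosed_iInter fun i => isClosed_iInter fun j =>
        isClosed_le continuous_const (continuous_id.matrix_elem i j)
    · exact isClosed_iInter fun i => isClosed_eq
        (continuous_finsetSum _ fun j _ => continuous_id.matrix_elem i j) continuous_const
    · exact isClosed_iInter fun j => isClosed_eq
        (continuous_finsetSum _ fun i _ => continuous_id.matrix_elem i j) continuous_const
  · rintro P ⟨hP, hrow, -⟩ i - j -
    refine ⟨hP i j, ?_⟩
    rw [← hrow i]
    exact Finset.single_le_sum (fun k _ => hP i k) (Finset.mem_univ j)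

theorem convex_transportPolytope {n m : ℕ} (a : Fin n → ℝ) (b : Fin m → ℝ) :
    Convex ℝ (transportPolytope a b) := by
  rintro P ⟨hP, hProw, hPcol⟩ Q ⟨hQ, hQrow, hQcol⟩ s t hs ht hst
  refine ⟨fun i j => ?_, fun i => ?_, fun j => ?_⟩
  · exact add_nonneg (mul_nonneg hs (hP i j)) (mul_nonneg ht (hQ i j))
  · simp [Finset.sum_add_distrib, ← Finset.mul_sum, hProw, hQrow, ← add_mul, hst]
  · simp [Finset.sum_add_distrib, ← Finset.mul_sum, hPcol, hQcol, ← add_mul, hst]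

theorem continuous_entropicOT {n m : ℕ} (C : Matrix (Fin n) (Fin m) ℝ) (ε : ℝ) :
    Continuous (entropicOT C ε) := by
  have h (i : Fin n) (j : Fin m) : Continuous fun P : Matrix (Fin n) (Fin m) ℝ => P i j :=
    continuous_id.matrix_elem i j
  refine .add ?_ (continuous_const.mul ?_)
  · exact continuous_finsetSum _ fun i _ => continuous_finsetSum _ fun j _ =>
      continuous_const.mul (h i j)
  · exact continuous_finsetSum _ fun i _ => continuous_finsetSum _ fun j _ =>
      Real.continuous_mul_log.comp (h i j)

/-- The entropic objective is strictly convex on the nonnegative orthant. -/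
theorem strictConvexOn_entropicOT {n m : ℕ} (C : Matrix (Fin n) (Fin m) ℝ) {ε : ℝ} (hε : 0 < ε) :
    StrictConvexOn ℝ {P : Matrix (Fin n) (Fin m) ℝ | ∀ i j, 0 ≤ P i j} (entropicOT C ε) := by
  refine ⟨fun P hP Q hQ s t hs ht _ i j =>
    add_nonneg (mul_nonneg hs (hP i j)) (mul_nonneg ht (hQ i j)), ?_⟩
  intro P hP Q hQ hPQ s t hs ht hst
  obtain ⟨i₀, j₀, hne⟩ : ∃ i j, P i j ≠ Q i j := by
    by_contra! h
    exact hPQ (Matrix.ext h)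
  have hle (i : Fin n) (j : Fin m) :
      (s • P + t • Q) i j * Real.log ((s • P + t • Q) i j) ≤
        s * (P i j * Real.log (P i j)) + t * (Q i j * Real.log (Q i j)) :=
    Real.convexOn_mul_log.2 (hP i j) (hQ i j) hs.le ht.le hst
  have hlt : ∑ i, ∑ j, (s • P + t • Q) i j * Real.log ((s • P + t • Q) i j) <
      ∑ i, ∑ j, (s * (P i j * Real.log (P i j)) + t * (Q i j * Real.log (Q i j))) :=
    Finset.sum_lt_sum (fun i _ => Finset.sum_le_sum fun j _ => hle i j)
      ⟨i₀, Finset.mem_univ _, Finset.sum_lt_sum (fun j _ => hle i₀ j)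
        ⟨j₀, Finset.mem_univ _,
          Real.strictConvexOn_mul_log.2 (hP i₀ j₀) (hQ i₀ j₀) hne hs ht hst⟩⟩
  have hlin : ∑ i, ∑ j, C i j * (s • P + t • Q) i j =
      s * ∑ i, ∑ j, C i j * P i j + t * ∑ i, ∑ j, C i j * Q i j := by
    simp only [Finset.mul_sum, ← Finset.sum_add_distrib, Matrix.add_apply, Matrix.smul_apply,
      smul_eq_mul]
    exact Finset.sum_congr rfl fun i _ => Finset.sum_congr rfl fun j _ => by ring
  simp only [Finset.sum_add_distrib, ← Finset.mul_sum] at hlt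
  simp only [entropicOT, hlin, smul_eq_mul]
  linarith [mul_lt_mul_of_pos_left hlt hε]

theorem stmt_8 {n m : ℕ} (a : Fin n → ℝ) (b : Fin m → ℝ)
    (ha : ∀ i, 0 ≤ a i) (hb : ∀ j, 0 ≤ b j)
    (hab : ∑ i, a i = ∑ j, b j)
    (hne : (transportPolytope a b).Nonempty)
    (C : Matrix (Fin n) (Fin m) ℝ) (ε : ℝ) (hε : 0 < ε) :
    ∃! P₀, P₀ ∈ transportPolytope a b ∧
      ∀ P ∈ transportPolytope a b, entropicOT C ε P₀ ≤ entropicOT C ε P := by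
  obtain ⟨P₀, hP₀, hmin⟩ := (isCompact_transportPolytope a b).exists_isMinOn hne
    (continuous_entropicOT C ε).continuousOn
  have hconv : StrictConvexOn ℝ (transportPolytope a b) (entropicOT C ε) :=
    (strictConvexOn_entropicOT C hε).subset (fun _ hP => hP.1) (convex_transportPolytope a b)
  exact ⟨P₀, ⟨hP₀, fun P hP => hmin hP⟩, fun Q hQ =>
    hconv.eq_of_isMinOn (fun P hP => hQ.2 P hP) hmin hQ.1 hP₀⟩
end

section
/- Fix parameter matrices W_Q, W_K : Matrix (Fin d) (Fin d_k) ℝ and W_V : Matrix (Fin d) (Fin d_v) ℝ. For an input X : Matrix (Fin n) (Fin d) ℝ, define the attention scores S(X) = (X · W_Q) · (X · W_K)ᵀ, the row-wise softmax softmaxRow(M) i j = exp(M i j) / Σ_{l ∈ Fin n} exp(M i l), and the attention output Attn(X) = softmaxRow(S(X)) · (X · W_V). Then for every permutation σ of Fin n with permutation matrix P_σ (P_σ i j = 1 if j = σ i, else 0), Attn(P_σ · X) = P_σ · Attn(X); i.e., the self-attention mechanism is permutation equivariant in its rows. -/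
open Matrix

/-- Row-wise softmax of a square matrix. -/
noncomputable def softmaxRow {n : ℕ} (M : Matrix (Fin n) (Fin n) ℝ) :
    Matrix (Fin n) (Fin n) ℝ :=
  fun i j => Real.exp (M i j) / ∑ l, Real.exp (M i l)

/-- Single-head self-attention with parameters `WQ`, `WK`, `WV`. -/
noncomputable def attn {n d dk dv : ℕ} (WQ WK : Matrix (Fin d) (Fin dk) ℝ)
    (WV : Matrix (Fin d) (Fin dv) ℝ) (X : Matrix (Fin n) (Fin d) ℝ) :
    Matrix (Fin n) (Fin dv) ℝ :=
  softmaxRow ((X * WQ) * (X * WK)ᵀ) * (X * WV)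

/-- The permutation matrix of `σ`: `P i j = 1` if `j = σ i`, else `0`. -/
def permMatrix {n : ℕ} (σ : Equiv.Perm (Fin n)) : Matrix (Fin n) (Fin n) ℝ :=
  fun i j => if j = σ i then 1 else 0

theorem permMatrix_mul {n m : ℕ} (σ : Equiv.Perm (Fin n)) (X : Matrix (Fin n) (Fin m) ℝ) :
    permMatrix σ * X = X.submatrix σ id := by
  ext i j
  simp [permMatrix, Matrix.mul_apply]

theorem softmaxRow_submatrix {n : ℕ} (σ : Equiv.Perm (Fin n)) (M : Matrix (Fin n) (Fin n) ℝ) :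
    softmaxRow (M.submatrix σ σ) = (softmaxRow M).submatrix σ σ := by
  ext i j
  simp only [softmaxRow, submatrix_apply]
  rw [Equiv.sum_comp σ fun l => Real.exp (M (σ i) l)]

theorem submatrix_id_mul {n d m : ℕ} (σ : Equiv.Perm (Fin n)) (X : Matrix (Fin n) (Fin d) ℝ)
    (W : Matrix (Fin d) (Fin m) ℝ) : X.submatrix σ id * W = (X * W).submatrix σ id := rfl

theorem stmt_14 {n d dk dv : ℕ} (WQ WK : Matrix (Fin d) (Fin dk) ℝ)
    (WV : Matrix (Fin d) (Fin dv) ℝ) (X : Matrix (Fin n) (Fin d) ℝ)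
    (σ : Equiv.Perm (Fin n)) :
    attn WQ WK WV (permMatrix σ * X) = permMatrix σ * attn WQ WK WV X := by
  have scores : (X * WQ).submatrix σ id * ((X * WK).submatrix σ id)ᵀ =
      ((X * WQ) * (X * WK)ᵀ).submatrix σ σ := rfl
  rw [permMatrix_mul, permMatrix_mul, attn, attn, submatrix_id_mul σ X WQ,
    submatrix_id_mul σ X WK, submatrix_id_mul σ X WV, scores,
    softmaxRow_submatrix, submatrix_mul_equiv]
end

section
/- Let n ≥ 2 and let E and E' be two distinct finite multisets of unordered pairs drawn from Sym2 (Fin n), each pair having distinct endpoints (no diagonal pairs). For a coordinate assignment x : Fin n → ℝ², define the total length L_E(x) = Σ_{{i,j} ∈ E} ‖x i − x j‖ (sum over the multiset, with multiplicity, of Euclidean distances). Then the set of coordinate assignments on which the two total lengths coincide, { x : (Fin n → ℝ²) : L_E(x) = L_{E'}(x) }, has Lebesgue measure zero in (ℝ²)^n. -/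
/-- The length of an unordered pair of indices under coordinates `x`. -/
noncomputable def sym2Dist {n : ℕ} (x : Fin n → EuclideanSpace ℝ (Fin 2)) :
    Sym2 (Fin n) → ℝ :=
  Sym2.lift ⟨fun i j => ‖x i - x j‖, fun i j => norm_sub_rev (x i) (x j)⟩

/-- The total length of an edge multiset under coordinates `x`, counted with
multiplicity. -/
noncomputable def totalLength {n : ℕ} (E : Multiset (Sym2 (Fin n)))
    (x : Fin n → EuclideanSpace ℝ (Fin 2)) : ℝ :=
  (E.map (sym2Dist x)).sum

open MeasureTheory Function

/-- A measurable planar set without the four vertices of a nondegenerate axis-parallel rectangle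
is null. -/
lemma volume_eq_zero_of_no_rectangle {S : Set (ℝ × ℝ)} (hS : MeasurableSet S)
    (h : ∀ s s' t t' : ℝ, s < s' → t < t' →
      (s, t) ∈ S → (s', t) ∈ S → (s, t') ∈ S → (s', t') ∈ S → False) :
    volume S = 0 := by
  rw [Measure.volume_eq_prod, Measure.measure_prod_null hS]
  have hlt : ∀ s s' : ℝ, s < s' → volume (Prod.mk s ⁻¹' S ∩ Prod.mk s' ⁻¹' S) = 0 := by
    intro s s' hss
    refine Set.Subsingleton.measure_zero (fun t ht t' ht' => ?_) volume
    rcases lt_trichotomy t t' with hlt | heq | hgt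
    · exact (h s s' t t' hss hlt ht.1 ht.2 ht'.1 ht'.2).elim
    · exact heq
    · exact (h s s' t' t hss hgt ht'.1 ht'.2 ht.1 ht.2).elim
  have hdisj : Pairwise (AEDisjoint volume on fun s : ℝ => Prod.mk s ⁻¹' S) := by
    intro s s' hne
    rcases hne.lt_or_gt with hss | hss
    · exact hlt s s' hss
    · exact AEDisjoint.symm (hlt s' s hss)
  have hcount := Measure.countable_meas_pos_of_disjoint_iUnion₀
    (fun s => (measurable_prodMk_left hS : MeasurableSet (Prod.mk s ⁻¹' S)).nullMeasurableSet) hdisj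
  filter_upwards [hcount.ae_notMem volume] with s hs
  simpa using hs

lemma strictConvexOn_sqrt_sq_add_sq {b : ℝ} (hb : b ≠ 0) :
    StrictConvexOn ℝ Set.univ fun r : ℝ => √(r ^ 2 + b ^ 2) := by
  refine ⟨convex_univ, fun p _ q _ hpq α β hα hβ hαβ => ?_⟩
  have hp : √(p ^ 2 + b ^ 2) ^ 2 = p ^ 2 + b ^ 2 := Real.sq_sqrt (by positivity)
  have hq : √(q ^ 2 + b ^ 2) ^ 2 = q ^ 2 + b ^ 2 := Real.sq_sqrt (by positivity)
  have hp0 : 0 ≤ √(p ^ 2 + b ^ 2) := Real.sqrt_nonneg _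
  have hq0 : 0 ≤ √(q ^ 2 + b ^ 2) := Real.sqrt_nonneg _
  simp only [smul_eq_mul]
  set P := √(p ^ 2 + b ^ 2)
  set Q := √(q ^ 2 + b ^ 2)
  have hPQ : p * q + b ^ 2 < P * Q := by
    refine lt_of_pow_lt_pow_left₀ 2 (by positivity) ?_
    rw [mul_pow, hp, hq]
    have : 0 < (b * (p - q)) ^ 2 := by
      have := mul_ne_zero hb (sub_ne_zero.2 hpq)
      positivity
    nlinarith
  have hP : 0 < P := Real.sqrt_pos.2 (by positivity)
  rw [Real.sqrt_lt' (by positivity)]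
  have hexp : (α * P + β * Q) ^ 2
      = α ^ 2 * (p ^ 2 + b ^ 2) + β ^ 2 * (q ^ 2 + b ^ 2) + 2 * (α * β) * (P * Q) := by
    rw [← hp, ← hq]; ring
  have hb2 : b ^ 2 = (α + β) ^ 2 * b ^ 2 := by rw [hαβ]; ring
  rw [hexp, hb2]
  nlinarith [mul_lt_mul_of_pos_left hPQ (mul_pos hα hβ), hb2]

/-- A strictly convex function of a difference is strictly submodular. -/
lemma StrictConvexOn.add_sub_lt {f : ℝ → ℝ} (hf : StrictConvexOn ℝ Set.univ f)
    {s s' t t' : ℝ} (hs : s < s') (ht : t < t') :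
    f (s - t) + f (s' - t') < f (s - t') + f (s' - t) := by
  have hd : 0 < (s' - s) + (t' - t) := by linarith
  have hne : s - t' ≠ s' - t := by intro h; linarith
  have hα : 0 < (s' - s) / ((s' - s) + (t' - t)) := div_pos (by linarith) hd
  have hβ : 0 < (t' - t) / ((s' - s) + (t' - t)) := div_pos (by linarith) hd
  have hαβ : (s' - s) / ((s' - s) + (t' - t)) + (t' - t) / ((s' - s) + (t' - t)) = 1 := by
    field_simp
  have h1 := hf.2 (Set.mem_univ _) (Set.mem_univ _) hne hα hβ hαβ
  have h2 := hf.2 (Set.mem_univ _) (Set.mem_univ _) hne hβ hα (by rw [add_comm, hαβ])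
  simp only [smul_eq_mul] at h1 h2
  set α := (s' - s) / ((s' - s) + (t' - t)) with hα_def
  set β := (t' - t) / ((s' - s) + (t' - t)) with hβ_def
  have e1 : α * (s - t') + β * (s' - t) = s - t := by
    rw [hα_def, hβ_def]; field_simp; ring
  have e2 : β * (s - t') + α * (s' - t) = s' - t' := by
    rw [hα_def, hβ_def]; field_simp; ring
  rw [e1] at h1
  rw [e2] at h2
  have hβ' : β = 1 - α := by linarith
  rw [hβ'] at h1 h2
  linarith

/-- Horizontal displacement of the nodes `i` and `j`. -/
noncomputable def horizontalShift {n : ℕ} (i j : Fin n) :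
    ℝ × ℝ →ₗ[ℝ] (Fin n → EuclideanSpace ℝ (Fin 2)) :=
  (LinearMap.single ℝ (fun _ => EuclideanSpace ℝ (Fin 2)) i ∘ₗ
      LinearMap.toSpanSingleton ℝ _ (EuclideanSpace.single 0 1)).coprod
    (LinearMap.single ℝ (fun _ => EuclideanSpace ℝ (Fin 2)) j ∘ₗ
      LinearMap.toSpanSingleton ℝ _ (EuclideanSpace.single 0 1))

lemma horizontalShift_apply {n : ℕ} (i j : Fin n) (s t : ℝ) :
    horizontalShift i j (s, t) =
      Pi.single i (s • EuclideanSpace.single 0 1) + Pi.single j (t • EuclideanSpace.single 0 1) := by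
  simp [horizontalShift]

lemma sym2Dist_mk {n : ℕ} (x : Fin n → EuclideanSpace ℝ (Fin 2)) (i j : Fin n) :
    sym2Dist x s(i, j) = ‖x i - x j‖ := rfl

lemma sym2Dist_add_horizontalShift {n : ℕ} {i j : Fin n} (hij : i ≠ j)
    (y : Fin n → EuclideanSpace ℝ (Fin 2)) (s t : ℝ) :
    sym2Dist (y + horizontalShift i j (s, t)) s(i, j) =
      √(((y i 0 + s) - (y j 0 + t)) ^ 2 + (y i 1 - y j 1) ^ 2) := by
  rw [sym2Dist_mk, EuclideanSpace.norm_eq, Fin.sum_univ_two]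
  simp [horizontalShift_apply, hij, hij.symm]

/-- The second mixed difference of the length of `e` over the rectangle with vertices
`(s, t)` and `(s', t')`, as the nodes `i` and `j` move horizontally. -/
noncomputable def mixedDifference {n : ℕ} (i j : Fin n) (y : Fin n → EuclideanSpace ℝ (Fin 2))
    (s s' t t' : ℝ) (e : Sym2 (Fin n)) : ℝ :=
  sym2Dist (y + horizontalShift i j (s, t)) e - sym2Dist (y + horizontalShift i j (s', t)) e
    - sym2Dist (y + horizontalShift i j (s, t')) e + sym2Dist (y + horizontalShift i j (s', t')) e

lemma mixedDifference_neg {n : ℕ} {i j : Fin n} (hij : i ≠ j)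
    {y : Fin n → EuclideanSpace ℝ (Fin 2)} (hy : y i 1 ≠ y j 1) {s s' t t' : ℝ}
    (hs : s < s') (ht : t < t') : mixedDifference i j y s s' t t' s(i, j) < 0 := by
  have := (strictConvexOn_sqrt_sq_add_sq (sub_ne_zero.2 hy)).add_sub_lt
    (add_lt_add_right hs (y i 0)) (add_lt_add_right ht (y j 0))
  simp only [mixedDifference, sym2Dist_add_horizontalShift hij]
  linarith

lemma mixedDifference_eq_zero {n : ℕ} {i j : Fin n} (hij : i ≠ j)
    (y : Fin n → EuclideanSpace ℝ (Fin 2)) (s s' t t' : ℝ) {e : Sym2 (Fin n)}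
    (he : e ≠ s(i, j)) : mixedDifference i j y s s' t t' e = 0 := by
  have hmem : i ∉ e ∨ j ∉ e := by
    by_contra! h
    exact he ((Sym2.mem_and_mem_iff hij).1 h)
  induction e with | _ a b =>
  simp only [mixedDifference, sym2Dist_mk, horizontalShift_apply, Pi.add_apply]
  simp only [Sym2.mem_iff, not_or] at hmem
  rcases hmem with ⟨ha, hb⟩ | ⟨ha, hb⟩
  · simp [Pi.single_eq_of_ne' ha, Pi.single_eq_of_ne' hb]
  · simp [Pi.single_eq_of_ne' ha, Pi.single_eq_of_ne' hb]

lemma totalLength_mixedDifference {n : ℕ} {i j : Fin n} (hij : i ≠ j)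
    (E : Multiset (Sym2 (Fin n))) (y : Fin n → EuclideanSpace ℝ (Fin 2)) (s s' t t' : ℝ) :
    totalLength E (y + horizontalShift i j (s, t)) - totalLength E (y + horizontalShift i j (s', t))
      - totalLength E (y + horizontalShift i j (s, t'))
      + totalLength E (y + horizontalShift i j (s', t'))
      = E.count s(i, j) * mixedDifference i j y s s' t t' s(i, j) := by
  rw [← nsmul_eq_mul, ← Multiset.sum_map_eq_nsmul_single (m := E) s(i, j)
    (fun e he _ => mixedDifference_eq_zero hij y s s' t t' he)]
  simp only [totalLength, mixedDifference, Multiset.sum_map_add, Multiset.sum_map_sub]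

lemma continuous_totalLength {n : ℕ} (E : Multiset (Sym2 (Fin n))) :
    Continuous (totalLength E) := by
  refine continuous_multiset_sum E fun e _ => ?_
  induction e with | _ a b =>
  simp only [sym2Dist_mk]
  fun_prop

/-- Almost every coordinate assignment gives two distinct nodes different heights. -/
lemma ae_height_ne {n : ℕ} {i j : Fin n} (hij : i ≠ j) :
    ∀ᵐ y : Fin n → EuclideanSpace ℝ (Fin 2), y i 1 ≠ y j 1 := by
  let φ : (Fin n → EuclideanSpace ℝ (Fin 2)) →ₗ[ℝ] ℝ :=
    { toFun := fun y => y i 1 - y j 1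
      map_add' := fun x y => by simp; ring
      map_smul' := fun c y => by simp; ring }
  have hφ : LinearMap.ker φ ≠ ⊤ := by
    intro htop
    have hmem : Pi.single i (EuclideanSpace.single 1 1) ∈ LinearMap.ker φ :=
      htop ▸ Submodule.mem_top
    have : φ (Pi.single i (EuclideanSpace.single 1 1)) = 0 := hmem
    simp [φ, hij.symm] at this
  have hnull := Measure.addHaar_submodule volume (LinearMap.ker φ) hφ
  filter_upwards [measure_eq_zero_iff_ae_notMem.1 hnull] with y hy hEq
  exact hy (sub_eq_zero.2 hEq)

theorem stmt_15 (n : ℕ) (hn : 2 ≤ n) (E E' : Multiset (Sym2 (Fin n)))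
    (hEd : ∀ e ∈ E, ¬ e.IsDiag) (hE'd : ∀ e ∈ E', ¬ e.IsDiag)
    (hne : E ≠ E') :
    MeasureTheory.volume {x : Fin n → EuclideanSpace ℝ (Fin 2) |
      totalLength E x = totalLength E' x} = 0 := by
  obtain ⟨e, hcount⟩ : ∃ e, E.count e ≠ E'.count e := by
    by_contra! h
    exact hne (Multiset.ext.2 h)
  have hdiag : ¬ e.IsDiag := by
    by_cases he : e ∈ E
    · exact hEd e he
    · by_cases he' : e ∈ E'
      · exact hE'd e he'
      · simp [Multiset.count_eq_zero_of_notMem he, Multiset.count_eq_zero_of_notMem he'] at hcount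
  induction e with | _ i j =>
  have hij : i ≠ j := by simpa using hdiag
  have hclosed : IsClosed {x : Fin n → EuclideanSpace ℝ (Fin 2) |
      totalLength E x = totalLength E' x} :=
    isClosed_eq (continuous_totalLength E) (continuous_totalLength E')
  rw [measure_eq_zero_iff_ae_notMem]
  refine (ae_ae_add_linearMap_mem_iff (horizontalShift i j) volume volume
    hclosed.measurableSet.compl).1 ?_
  filter_upwards [ae_height_ne hij] with y hy
  refine measure_eq_zero_iff_ae_notMem.1 (volume_eq_zero_of_no_rectangle
    (S := {p | totalLength E (y + horizontalShift i j p)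
      = totalLength E' (y + horizontalShift i j p)}) ?_ ?_)
  · have hcont : Continuous fun p => y + horizontalShift i j p :=
      continuous_const.add (horizontalShift i j).continuous_of_finiteDimensional
    exact (hclosed.preimage hcont).measurableSet
  · intro s s' t t' hs ht h₁ h₂ h₃ h₄
    have h := totalLength_mixedDifference hij E y s s' t t'
    rw [Set.mem_ofPred_eq] at h₁ h₂ h₃ h₄
    rw [h₁, h₂, h₃, h₄, totalLength_mixedDifference hij E' y s s' t t'] at h
    exact hcount (Nat.cast_injective
      (mul_right_cancel₀ (mixedDifference_neg hij hy hs ht).ne h)).symm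
end
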